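/- Let G be a Garside group of finite type, x ∈ G, y ∈ SC(x) and s a positive element, and write c_s = c_s(y). Assume p is a positive element with p ⪯ c_s and y^p ∈ SSS(x), and that F(p) ≠ {1}. Then: (1) if there exists v ∈ F(p) with s ⪯ v, then c_s = v; (2) if s is not a prefix of any element of F(p), then c_s is not an indecomposable conjugator starting at y. -/

import Mathlib

/-- A Garside structure of finite type on a group `G`: a submonoid `P` of positive
elements with `P ∩ P⁻¹ = {1}`, such that the prefix order `a ⪯ b ↔ a⁻¹ * b ∈ P` is a
lattice order (with meet `wedge` and join `vee`), together with a Garside element `Δ ∈ P`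
whose set of prefixes (the simple elements) is finite and generates `G`, satisfying
`Δ⁻¹ P Δ = P`, and such that every nontrivial positive element has a finite norm. -/
structure GarsideStructure (G : Type*) [Group G] where
  P : Set G
  one_mem : (1 : G) ∈ P
  mul_mem : ∀ {a b : G}, a ∈ P → b ∈ P → a * b ∈ P
  eq_one_of_mem_of_inv_mem : ∀ a : G, a ∈ P → a⁻¹ ∈ P → a = 1
  wedge : G → G → G
  vee : G → G → G
  wedge_le_left : ∀ a b : G, (wedge a b)⁻¹ * a ∈ P
  wedge_le_right : ∀ a b : G, (wedge a b)⁻¹ * b ∈ P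
  le_wedge : ∀ a b c : G, c⁻¹ * a ∈ P → c⁻¹ * b ∈ P → c⁻¹ * wedge a b ∈ P
  le_vee_left : ∀ a b : G, a⁻¹ * vee a b ∈ P
  le_vee_right : ∀ a b : G, b⁻¹ * vee a b ∈ P
  vee_le : ∀ a b c : G, a⁻¹ * c ∈ P → b⁻¹ * c ∈ P → (vee a b)⁻¹ * c ∈ P
  Δ : G
  Δ_mem : Δ ∈ P
  simples_finite : {s : G | s ∈ P ∧ s⁻¹ * Δ ∈ P}.Finite
  simples_generate : Subgroup.closure {s : G | s ∈ P ∧ s⁻¹ * Δ ∈ P} = (⊤ : Subgroup G)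
  conj_Delta_mem : ∀ a : G, a ∈ P → Δ⁻¹ * a * Δ ∈ P
  mem_of_conj_Delta_mem : ∀ a : G, Δ⁻¹ * a * Δ ∈ P → a ∈ P
  norm_bounded : ∀ x : G, x ∈ P → x ≠ 1 →
    ∃ n : ℕ, ∀ L : List G, (∀ a ∈ L, a ∈ P ∧ a ≠ 1) → L.prod = x → L.length ≤ n

namespace GarsideStructure

variable {G : Type*} [Group G] (gs : GarsideStructure G)

/-- The prefix order: `a ⪯ b`. -/
def pre (a b : G) : Prop := a⁻¹ * b ∈ gs.P

/-- The suffix order: `a ≽ b` (i.e. `b` is a suffix of `a`). -/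
def rdvd (a b : G) : Prop := a * b⁻¹ ∈ gs.P

/-- Greatest common divisor with respect to the suffix order `≽` : `a ∧↰ b`. -/
def rwedge (a b : G) : G := (gs.vee a⁻¹ b⁻¹)⁻¹

/-- Least common multiple with respect to the suffix order `≽` : `a ∨↰ b`. -/
def rvee (a b : G) : G := (gs.wedge a⁻¹ b⁻¹)⁻¹

/-- Simple elements: positive prefixes of `Δ`. -/
def simple (s : G) : Prop := s ∈ gs.P ∧ s⁻¹ * gs.Δ ∈ gs.P

/-- Atoms: nontrivial positive elements which cannot be decomposed in `P`. -/
def atom (a : G) : Prop := a ∈ gs.P ∧ a ≠ 1 ∧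
  ∀ b c : G, b ∈ gs.P → c ∈ gs.P → a = b * c → b = 1 ∨ c = 1

/-- `inf x` : the maximal integer `p` with `Δ^p ⪯ x`. -/
noncomputable def ginf (x : G) : ℤ := sSup {p : ℤ | gs.pre (gs.Δ ^ p) x}

/-- `sup x` : the minimal integer `p` with `x ⪯ Δ^p`. -/
noncomputable def gsup (x : G) : ℤ := sInf {p : ℤ | gs.pre x (gs.Δ ^ p)}

/-- Canonical length `ℓ(x) = sup(x) - inf(x)`. -/
noncomputable def glen (x : G) : ℤ := gs.gsup x - gs.ginf x

/-- `‖x‖` : the maximal number of factors in a decomposition of `x` as a product of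
nontrivial positive elements. -/
noncomputable def gnorm (x : G) : ℕ :=
  sSup {k : ℕ | ∃ L : List G, (∀ a ∈ L, a ∈ gs.P ∧ a ≠ 1) ∧ L.prod = x ∧ L.length = k}

/-- The summit infimum `inf_s(x)` : the maximum of `inf` over the conjugacy class of `x`. -/
noncomputable def ginfs (x : G) : ℤ :=
  sSup {p : ℤ | ∃ y : G, (∃ α : G, α⁻¹ * x * α = y) ∧ p = gs.ginf y}

/-- The summit supremum `sup_s(x)` : the minimum of `sup` over the conjugacy class of `x`. -/
noncomputable def gsups (x : G) : ℤ :=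
  sInf {p : ℤ | ∃ y : G, (∃ α : G, α⁻¹ * x * α = y) ∧ p = gs.gsup y}

/-- The preferred prefix `𝔭(x) = (xΔ^{-inf x}) ∧ (x⁻¹Δ^{sup x}) ∧ Δ`. -/
noncomputable def pp (x : G) : G :=
  gs.wedge (gs.wedge (x * gs.Δ ^ (-gs.ginf x)) (x⁻¹ * gs.Δ ^ gs.gsup x)) gs.Δ

/-- Cyclic (left) sliding `𝔰(x) = 𝔭(x)⁻¹ x 𝔭(x)`. -/
noncomputable def sl (x : G) : G := (gs.pp x)⁻¹ * x * gs.pp x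

/-- The preferred suffix `𝔭↰(x) = (Δ^{-inf x}x) ∧↰ (Δ^{sup x}x⁻¹) ∧↰ Δ`. -/
noncomputable def ps (x : G) : G :=
  gs.rwedge (gs.rwedge (gs.Δ ^ (-gs.ginf x) * x) (gs.Δ ^ gs.gsup x * x⁻¹)) gs.Δ

/-- Cyclic right sliding `𝔰↰(x) = 𝔭↰(x) x 𝔭↰(x)⁻¹`. -/
noncomputable def rsl (x : G) : G := gs.ps x * x * (gs.ps x)⁻¹

/-- The super summit set `SSS(x)` : conjugates of `x` with maximal infimum and minimal
supremum among all conjugates of `x`. -/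
def SSS (x : G) : Set G :=
  {y | (∃ α : G, α⁻¹ * x * α = y) ∧
    ∀ z : G, (∃ α : G, α⁻¹ * x * α = z) → gs.ginf z ≤ gs.ginf y ∧ gs.gsup y ≤ gs.gsup z}

/-- The set of sliding circuits `SC(x)` : conjugates `y` of `x` with `𝔰^m(y) = y` for
some `m ≥ 1`. -/
noncomputable def SC (x : G) : Set G :=
  {y | (∃ α : G, α⁻¹ * x * α = y) ∧ ∃ m : ℕ, 1 ≤ m ∧ (gs.sl)^[m] y = y}

/-- The transport `α^{(1)} = 𝔭(x)⁻¹ α 𝔭(x^α)` of `α` at `x`. -/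
noncomputable def transport (x α : G) : G := (gs.pp x)⁻¹ * α * gs.pp (α⁻¹ * x * α)

/-- Iterated transport `α^{(i)}` of `α` at `x`: `α^{(0)} = α` and `α^{(i+1)}` is the
transport of `α^{(i)}` at `𝔰^i(x)`. -/
noncomputable def transportIter (x α : G) : ℕ → G
  | 0 => α
  | i + 1 => gs.transport ((gs.sl)^[i] x) (transportIter x α i)

/-- `c` is the `⪯`-minimal element `c_s(y)` satisfying `s ⪯ c` and `y^c ∈ SC(x)`. -/
def IsMinSCConj (x y s c : G) : Prop :=
  gs.pre s c ∧ (c⁻¹ * y * c) ∈ gs.SC x ∧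
    ∀ d : G, gs.pre s d → (d⁻¹ * y * d) ∈ gs.SC x → gs.pre c d

/-- `s` is an indecomposable conjugator starting at `u`: `u^s ∈ SC(x)`, `s ≠ 1` and there
is no `t` with `1 ≺ t ≺ s` and `u^t ∈ SC(x)`. -/
def IsIndecomposableConjugator (x u s : G) : Prop :=
  (s⁻¹ * u * s) ∈ gs.SC x ∧ s ≠ 1 ∧
    ¬ ∃ t : G, (gs.pre 1 t ∧ t ≠ 1) ∧ (gs.pre t s ∧ t ≠ s) ∧ (t⁻¹ * u * t) ∈ gs.SC x

/-- `u` is the pullback of `s` at `y = 𝔰(z)` : the `⪯`-minimal positive element with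
`z^u ∈ SSS(x)` and `s ⪯ u^{(1)}` (transport at `z`). -/
def IsPullback (x z s u : G) : Prop :=
  u ∈ gs.P ∧ (u⁻¹ * z * u) ∈ gs.SSS x ∧ gs.pre s (gs.transport z u) ∧
    ∀ u' : G, u' ∈ gs.P → (u'⁻¹ * z * u') ∈ gs.SSS x → gs.pre s (gs.transport z u') →
      gs.pre u u'

/-- The pullback `s_{(1)}` of `s` at `y = 𝔰(z)`. -/
noncomputable def pullbackOne (x z s : G) : G :=
  @Classical.epsilon G ⟨1⟩ (fun u => gs.IsPullback x z s u)

/-- The `k`-fold pullback `s_{(k)}` of `s` at `y = 𝔰^k(z)` (an element at `z`):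
`s_{(0)} = s` and `s_{(k+1)}` is the pullback at `𝔰(z)` (relative to `z`) of the `k`-fold
pullback of `s` at `𝔰^k(𝔰(z)) = y`. -/
noncomputable def pullbackIter (x : G) : G → ℕ → G → G
  | _, 0, s => s
  | z, k + 1, s => gs.pullbackOne x z (pullbackIter x (gs.sl z) k s)

end GarsideStructure

open GarsideStructure

variable {G : Type*} [Group G]

section SlideMap

variable {L : Type*} [Lattice L]

theorem exists_succ_eq_of_antitone (hfin : ∀ a b : L, (Set.Icc a b).Finite)
    {u : ℕ → L} (hu : Antitone u) {b : L} (hb : ∀ n, b ≤ u n) : ∃ n, u (n + 1) = u n := by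
  by_contra! h
  have hs : StrictAnti u := strictAnti_nat_of_succ_lt fun n =>
    lt_of_le_of_ne (hu (Nat.le_succ n)) (h n)
  exact Set.infinite_of_injective_forall_mem hs.injective
    (fun n => (⟨hb n, hu (Nat.zero_le n)⟩ : u n ∈ Set.Icc b (u 0))) (hfin _ _)

theorem exists_succ_eq_of_monotone (hfin : ∀ a b : L, (Set.Icc a b).Finite)
    {u : ℕ → L} (hu : Monotone u) {b : L} (hb : ∀ n, u n ≤ b) : ∃ n, u (n + 1) = u n := by
  by_contra! h
  have hs : StrictMono u := strictMono_nat_of_lt_succ fun n =>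
    lt_of_le_of_ne (hu (Nat.le_succ n)) (h n).symm
  exact Set.infinite_of_injective_forall_mem hs.injective
    (fun n => (⟨hu (Nat.zero_le n), hb n⟩ : u n ∈ Set.Icc (u 0) b)) (hfin _ _)

/-- The pointwise meet of two order automorphisms. -/
def meetMap (φ D : L ≃o L) (a : L) : L := φ a ⊓ D a

/-- The pointwise meet of three order automorphisms. -/
def slideMap (φ ψ D : L ≃o L) (a : L) : L := φ a ⊓ ψ a ⊓ D a

theorem meetMap_mono (φ D : L ≃o L) : Monotone (meetMap φ D) := fun _ _ h =>
  inf_le_inf (φ.monotone h) (D.monotone h)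

theorem slideMap_mono (φ ψ D : L ≃o L) : Monotone (slideMap φ ψ D) := fun _ _ h =>
  inf_le_inf (inf_le_inf (φ.monotone h) (ψ.monotone h)) (D.monotone h)

theorem slideMap_swap (φ ψ D : L ≃o L) : slideMap φ ψ D = slideMap ψ φ D := by
  funext a; simp only [slideMap, inf_comm (φ a)]

theorem meetMap_commute {φ D χ : L ≃o L} (h₁ : Function.Commute χ φ)
    (h₂ : Function.Commute χ D) : Function.Commute χ (meetMap φ D) := fun a => by
  simp only [meetMap, map_inf, h₁ a, h₂ a]

theorem slideMap_commute {φ ψ D χ : L ≃o L} (h₁ : Function.Commute χ φ)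
    (h₂ : Function.Commute χ ψ) (h₃ : Function.Commute χ D) :
    Function.Commute χ (slideMap φ ψ D) := fun a => by
  simp only [slideMap, map_inf, h₁ a, h₂ a, h₃ a]

theorem le_apply_slideMap_iterate {φ ψ D χ : L ≃o L} (h₁ : Function.Commute χ φ)
    (h₂ : Function.Commute χ ψ) (h₃ : Function.Commute χ D) {a : L} (h : a ≤ χ a) (n : ℕ) :
    (slideMap φ ψ D)^[n] a ≤ χ ((slideMap φ ψ D)^[n] a) := by
  rw [((slideMap_commute h₁ h₂ h₃).iterate_right n) a]
  exact (slideMap_mono φ ψ D).iterate n h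

theorem meetMap_inf_le_apply {φ ψ D : L ≃o L}
    (hφD : Function.Commute φ D) {l : ℕ}
    (hl : ∀ a, φ (ψ a) = D^[l] a) (hl2 : 2 ≤ l) (hD : ∀ a, a ≤ D a) (e : L) (n : ℕ) :
    (meetMap φ D)^[n + 1] e ⊓ D ((meetMap ψ D)^[n] e) ≤ φ ((meetMap ψ D)^[n] e) := by
  have hDl : ∀ a, D (D a) ≤ D^[l] a := fun a => by
    obtain ⟨k, rfl⟩ := Nat.exists_eq_add_of_le' hl2
    rw [Function.iterate_add_apply]
    exact D.monotone.le_iterate_of_le (show id ≤ D from hD) k (D (D a)) |>.trans' (by simp)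
  induction n with
  | zero => exact inf_le_left.trans inf_le_left
  | succ n ih =>
    rw [Function.iterate_succ_apply' (meetMap ψ D), Function.iterate_succ_apply' _ (n + 1)]
    set r := (meetMap ψ D)^[n] e
    set t := (meetMap φ D)^[n + 1] e
    have h1 : D (meetMap ψ D r) ≤ φ (ψ r) := by
      rw [hl]
      exact (D.monotone inf_le_right).trans (hDl r)
    have h2 : meetMap φ D t ⊓ D (meetMap ψ D r) ≤ φ (D r) := by
      rw [hφD r]
      refine le_trans ?_ (D.monotone ih)
      rw [map_inf]
      exact inf_le_inf inf_le_right (D.monotone inf_le_right)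
    rw [meetMap, meetMap, map_inf φ]
    exact le_inf (inf_le_right.trans h1) h2

theorem slideMap_iterate_eq {φ ψ D : L ≃o L} (hφψ : Function.Commute φ ψ)
    (hφD : Function.Commute φ D) (hψD : Function.Commute ψ D) {l : ℕ}
    (hl : ∀ a, φ (ψ a) = D^[l] a) (hl2 : 2 ≤ l) (hD : ∀ a, a ≤ D a) (e : L) (n : ℕ) :
    (slideMap φ ψ D)^[n] e = (meetMap φ D)^[n] e ⊓ (meetMap ψ D)^[n] e := by
  induction n with
  | zero => simp
  | succ n ih =>
    have h1 := meetMap_inf_le_apply hφD hl hl2 hD e n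
    have h2 := meetMap_inf_le_apply hψD (fun a => (hφψ a).symm.trans (hl a)) hl2 hD e n
    rw [Function.iterate_succ_apply'] at h1 h2 ⊢
    rw [ih, Function.iterate_succ_apply', Function.iterate_succ_apply']
    set t := (meetMap φ D)^[n] e
    set r := (meetMap ψ D)^[n] e
    simp only [slideMap, meetMap, map_inf] at h1 h2 ⊢
    apply le_antisymm
    · refine le_inf (le_inf ?_ ?_) (le_inf ?_ ?_)
      · exact inf_le_left.trans (inf_le_left.trans inf_le_left)
      · exact inf_le_right.trans inf_le_left
      · exact inf_le_left.trans (inf_le_right.trans inf_le_right)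
      · exact inf_le_right.trans inf_le_right
    · refine le_inf (le_inf (le_inf ?_ ?_) (le_inf ?_ ?_)) (le_inf ?_ ?_)
      · exact inf_le_left.trans inf_le_left
      · exact le_trans (inf_le_inf le_rfl inf_le_right) h1
      · refine le_trans ?_ h2
        rw [inf_comm]
        exact inf_le_inf le_rfl inf_le_right
      · exact inf_le_right.trans inf_le_left
      · exact inf_le_left.trans inf_le_right
      · exact inf_le_right.trans inf_le_right

/-- If some point `β` satisfies `D β ≤ φ β`, then so does some iterate of `e` under the
sliding map. -/
theorem exists_slideMap_iterate_le {φ ψ D : L ≃o L} (hφψ : Function.Commute φ ψ)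
    (hφD : Function.Commute φ D) (hψD : Function.Commute ψ D) {l : ℕ}
    (hl : ∀ a, φ (ψ a) = D^[l] a) (hD : ∀ a, a ≤ D a)
    (hfin : ∀ a b : L, (Set.Icc a b).Finite) {e β : L} (hφe : e ≤ φ e) (hψe : e ≤ ψ e)
    {K : ℕ} (heβ : e ≤ β) (hβK : β ≤ D^[K] e) (hβ : D β ≤ φ β) :
    ∃ n, D ((slideMap φ ψ D)^[n] e) ≤ φ ((slideMap φ ψ D)^[n] e) := by
  have hDφ : ∀ n, D^[n] β ≤ φ^[n] β := fun n => by
    induction n with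
    | zero => exact le_rfl
    | succ n ih =>
      rw [Function.iterate_succ_apply' φ, Function.iterate_succ_apply]
      calc D^[n] (D β) ≤ D^[n] (φ β) := D.monotone.iterate n hβ
        _ = φ (D^[n] β) := ((hφD.iterate_right n) β).symm
        _ ≤ φ (φ^[n] β) := φ.monotone ih
  have hsD : ∀ n a, D.symm^[n] (D^[n] a) = a := fun n =>
    (Function.LeftInverse.iterate D.symm_apply_apply n)
  rcases Nat.lt_or_ge l 2 with hl2 | hl2
  · interval_cases l
    · -- here `φ` and `ψ` are mutually inverse, so both fix `e`
      refine ⟨0, ?_⟩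
      have hφe' : φ e = e := le_antisymm (by simpa [hl] using φ.monotone hψe) hφe
      have h1 : D^[K] (D e) ≤ D^[K] e :=
        calc D^[K] (D e) = D^[K + 1] e := rfl
          _ ≤ D^[K + 1] β := D.monotone.iterate _ heβ
          _ ≤ φ^[K + 1] β := hDφ _
          _ ≤ φ^[K + 1] (D^[K] e) := φ.monotone.iterate _ hβK
          _ = D^[K] (φ^[K + 1] e) := (hφD.iterate_iterate _ _) e
          _ = D^[K] e := by rw [Function.iterate_fixed hφe']
      have h2 : D e ≤ e := by simpa only [hsD] using D.symm.monotone.iterate K h1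
      simpa [hφe'] using h2
    · have hψβ : ψ β ≤ β := φ.le_iff_le.1 (by rw [hl]; exact hβ)
      set S := slideMap φ ψ D with hS
      have hSe : e ≤ S e := le_inf (le_inf hφe hψe) (hD e)
      have hmono : Monotone fun n => S^[n] e :=
        (slideMap_mono φ ψ D).monotone_iterate_of_le_map hSe
      have hSβ : S β ≤ β := (inf_le_left.trans inf_le_right).trans hψβ
      have hbd : ∀ n, S^[n] e ≤ β := fun n =>
        ((slideMap_mono φ ψ D).iterate n heβ).trans
          ((slideMap_mono φ ψ D).antitone_iterate_of_map_le hSβ (Nat.zero_le n))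
      obtain ⟨n, hn⟩ := exists_succ_eq_of_monotone hfin hmono hbd
      refine ⟨n, ?_⟩
      have hφa := le_apply_slideMap_iterate (Function.Commute.refl φ) hφψ hφD hφe n
      have hψa := le_apply_slideMap_iterate hφψ.symm (Function.Commute.refl ψ) hψD hψe n
      have hea : e ≤ S^[n] e := hmono (Nat.zero_le n)
      have haβ := hbd n
      rw [← hS] at hφa hψa
      simp only [Function.iterate_succ_apply'] at hn
      generalize S^[n] e = a at *
      have hφaD : φ a ≤ D a := (φ.monotone hψa).trans (by rw [hl]; exact le_rfl)
      have hψaD : ψ a ≤ D a := (ψ.monotone hφa).trans (by rw [← hφψ, hl]; exact le_rfl)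
      have hmeet : φ a ⊓ ψ a = a := by
        rw [hS, slideMap, inf_eq_left.2 (inf_le_left.trans hφaD)] at hn
        exact hn
      have hrigid : ∀ i, φ^[i + 1] a ⊓ ψ a ≤ a := fun i => by
        induction i with
        | zero => exact hmeet.le
        | succ i ih =>
          have h : φ^[i + 2] a ⊓ D a ≤ φ a := by
            have := φ.monotone ih
            rwa [map_inf, hl, ← Function.iterate_succ_apply' φ] at this
          calc φ^[i + 2] a ⊓ ψ a ≤ φ a ⊓ ψ a :=
                le_inf ((inf_le_inf le_rfl hψaD).trans h) inf_le_right
            _ = a := hmeet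
      have hDa : D a ≤ φ^[K + 1] a := by
        have h1 : D^[K] (D a) ≤ D^[K] (φ^[K + 1] a) :=
          calc D^[K] (D a) = D^[K + 1] a := rfl
            _ ≤ D^[K + 1] β := D.monotone.iterate _ haβ
            _ ≤ φ^[K + 1] β := hDφ _
            _ ≤ φ^[K + 1] (D^[K] a) :=
              φ.monotone.iterate _ (hβK.trans (D.monotone.iterate _ hea))
            _ = D^[K] (φ^[K + 1] a) := (hφD.iterate_iterate _ _) a
        simpa only [hsD] using D.symm.monotone.iterate K h1
      have hψa' : ψ a ≤ a := (le_inf (hψaD.trans hDa) le_rfl).trans (hrigid K)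
      have := φ.monotone hψa'
      rwa [hl] at this
  · have hTβ : meetMap φ D β = D β := inf_eq_right.2 hβ
    have hDT : Function.Commute D (meetMap φ D) :=
      meetMap_commute hφD.symm (Function.Commute.refl D)
    have hTnβ : ∀ n, (meetMap φ D)^[n] β = D^[n] β := fun n => by
      induction n with
      | zero => rfl
      | succ n ih =>
        rw [Function.iterate_succ_apply, hTβ, ← (hDT.iterate_right n) β, ih,
          Function.iterate_succ_apply']
    have hDs : ∀ n a, D^[n] (D.symm^[n] a) = a := fun n =>
      (Function.RightInverse.iterate D.apply_symm_apply n)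
    have hanti : Antitone fun n => D.symm^[n] ((meetMap φ D)^[n] e) :=
      antitone_nat_of_succ_le fun n => by
        rw [Function.iterate_succ_apply, Function.iterate_succ_apply' (meetMap φ D)]
        refine D.symm.monotone.iterate n ?_
        exact (D.symm.monotone inf_le_right).trans_eq (D.symm_apply_apply _)
    have hbd : ∀ n, D.symm^[K] e ≤ D.symm^[n] ((meetMap φ D)^[n] e) := fun n => by
      have h1 : D^[n] e ≤ D^[K] ((meetMap φ D)^[n] e) :=
        calc D^[n] e ≤ D^[n] β := D.monotone.iterate _ heβ
          _ = (meetMap φ D)^[n] β := (hTnβ n).symm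
          _ ≤ (meetMap φ D)^[n] (D^[K] e) := (meetMap_mono φ D).iterate n hβK
          _ = D^[K] ((meetMap φ D)^[n] e) := ((hDT.iterate_iterate K n) e).symm
      have h2 := D.symm.monotone.iterate n (D.symm.monotone.iterate K h1)
      rw [hsD, ((Function.Commute.refl D.symm).iterate_iterate n K), hsD] at h2
      exact h2
    obtain ⟨n, hn⟩ := exists_succ_eq_of_antitone hfin hanti hbd
    have hT : (meetMap φ D)^[n + 1] e = D ((meetMap φ D)^[n] e) := by
      have := congrArg (D^[n + 1]) hn
      rwa [hDs, Function.iterate_succ_apply' D, hDs] at this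
    refine ⟨n, ?_⟩
    rw [slideMap_iterate_eq hφψ hφD hψD hl hl2 hD, map_inf, map_inf]
    refine le_inf ?_ ?_
    · rw [← hT, Function.iterate_succ_apply']
      exact inf_le_left.trans inf_le_left
    · rw [← hT]
      exact meetMap_inf_le_apply hφD hl hl2 hD e n

end SlideMap

namespace GarsideStructure

variable (gs : GarsideStructure G)

theorem pre_refl (a : G) : gs.pre a a := by simpa [pre] using gs.one_mem

variable {gs} in
theorem pre.trans {a b c : G} (h₁ : gs.pre a b) (h₂ : gs.pre b c) : gs.pre a c := by
  simpa [pre, mul_assoc] using gs.mul_mem h₁ h₂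

variable {gs} in
theorem pre.antisymm {a b : G} (h₁ : gs.pre a b) (h₂ : gs.pre b a) : a = b := by
  have h := gs.eq_one_of_mem_of_inv_mem _ h₁ (by simpa [pre] using h₂)
  exact (inv_mul_eq_one.1 h)

theorem pre_mul_left_iff (g : G) {a b : G} : gs.pre (g * a) (g * b) ↔ gs.pre a b := by
  simp [pre, mul_assoc]

theorem conj_Delta_mem_iff (a : G) : gs.Δ⁻¹ * a * gs.Δ ∈ gs.P ↔ a ∈ gs.P :=
  ⟨gs.mem_of_conj_Delta_mem a, gs.conj_Delta_mem a⟩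

theorem conj_Delta_zpow_mem_iff (k : ℤ) (a : G) :
    (gs.Δ ^ k)⁻¹ * a * gs.Δ ^ k ∈ gs.P ↔ a ∈ gs.P := by
  induction k with
  | zero => simp
  | succ n ih =>
    rw [← ih, ← gs.conj_Delta_mem_iff ((gs.Δ ^ (n : ℤ))⁻¹ * a * gs.Δ ^ (n : ℤ))]
    simp [zpow_add_one, mul_assoc]
  | pred n ih =>
    rw [← ih, ← gs.conj_Delta_mem_iff ((gs.Δ ^ (-(n : ℤ) - 1))⁻¹ * a * gs.Δ ^ (-(n : ℤ) - 1))]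
    simp [zpow_sub_one, mul_assoc]

theorem pre_mul_Delta_zpow_iff (k : ℤ) {a b : G} :
    gs.pre (a * gs.Δ ^ k) (b * gs.Δ ^ k) ↔ gs.pre a b := by
  rw [pre, pre, ← gs.conj_Delta_zpow_mem_iff k (a⁻¹ * b)]
  simp [mul_assoc]

theorem Delta_pow_mem (n : ℕ) : gs.Δ ^ n ∈ gs.P := by
  induction n with
  | zero => simpa using gs.one_mem
  | succ n ih => rw [pow_succ]; exact gs.mul_mem ih gs.Δ_mem

theorem pre_mul_Delta (a : G) : gs.pre a (a * gs.Δ) := by simpa [pre] using gs.Δ_mem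

/-- The lattice structure given by the prefix order. -/
@[reducible] def lattice : Lattice G where
  le := gs.pre
  le_refl := gs.pre_refl
  le_trans _ _ _ := pre.trans
  le_antisymm _ _ := pre.antisymm
  inf := gs.wedge
  inf_le_left := gs.wedge_le_left
  inf_le_right := gs.wedge_le_right
  le_inf c a b := gs.le_wedge a b c
  sup := gs.vee
  le_sup_left := gs.le_vee_left
  le_sup_right := gs.le_vee_right
  sup_le := gs.vee_le

/-- The automorphism `a ↦ y a Δ^k` of the prefix order. -/
def twist (y : G) (k : ℤ) : letI := gs.lattice; G ≃o G :=
  letI := gs.lattice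
  { toFun := fun a => y * a * gs.Δ ^ k
    invFun := fun a => y⁻¹ * a * gs.Δ ^ (-k)
    left_inv := fun a => by simp [mul_assoc]
    right_inv := fun a => by simp [mul_assoc]
    map_rel_iff' := fun {a b} =>
      (gs.pre_mul_Delta_zpow_iff k).trans (gs.pre_mul_left_iff y) }

theorem twist_apply (y : G) (k : ℤ) (a : G) :
    letI := gs.lattice
    gs.twist y k a = y * a * gs.Δ ^ k := rfl

theorem twist_wedge (y : G) (k : ℤ) (a b : G) :
    letI := gs.lattice
    gs.twist y k (gs.wedge a b) = gs.wedge (gs.twist y k a) (gs.twist y k b) :=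
  let := gs.lattice
  (gs.twist y k).map_inf a b

theorem twist_commute {y z : G} (h : Commute y z) (k l : ℤ) :
    letI := gs.lattice
    Function.Commute (gs.twist y k) (gs.twist z l) := by
  let := gs.lattice
  intro a
  simp only [twist_apply, mul_assoc, ← zpow_add]
  rw [add_comm l k, ← mul_assoc y z, h.eq, mul_assoc z y]

theorem twist_one_iterate (n : ℕ) (a : G) :
    letI := gs.lattice
    (gs.twist 1 1)^[n] a = a * gs.Δ ^ (n : ℤ) := by
  let := gs.lattice
  induction n with
  | zero => simp
  | succ n ih =>
    rw [Function.iterate_succ_apply', ih, twist_apply]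
    simp [mul_assoc, zpow_add_one]

theorem pre_Delta_zpow_conj_iff (r : ℤ) (y α : G) :
    letI := gs.lattice
    gs.pre (gs.Δ ^ r) (α⁻¹ * y * α) ↔ gs.pre α (gs.twist y (-r) α) := by
  let := gs.lattice
  rw [pre, pre, ← gs.conj_Delta_zpow_mem_iff r (α⁻¹ * _), twist_apply]
  simp [mul_assoc]

theorem pre_conj_Delta_zpow_iff (r : ℤ) (y α : G) :
    letI := gs.lattice
    gs.pre (α⁻¹ * y * α) (gs.Δ ^ r) ↔ gs.pre α (gs.twist y⁻¹ r α) := by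
  let := gs.lattice
  rw [pre, pre, twist_apply]
  simp [mul_assoc]

theorem exists_Delta_pow_bounds (x : G) :
    ∃ K : ℕ, gs.pre (gs.Δ ^ (-(K : ℤ))) x ∧ gs.pre x (gs.Δ ^ (K : ℤ)) := by
  have hx : x ∈ Subgroup.closure {s : G | s ∈ gs.P ∧ s⁻¹ * gs.Δ ∈ gs.P} := by
    rw [gs.simples_generate]; trivial
  induction hx using Subgroup.closure_induction with
  | mem s hs =>
    refine ⟨1, ?_, by simpa [pre] using hs.2⟩
    simpa [pre] using gs.mul_mem gs.Δ_mem hs.1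
  | one => exact ⟨0, by simpa using gs.pre_refl 1, by simpa using gs.pre_refl 1⟩
  | mul a b _ _ ha hb =>
    obtain ⟨K, ha₁, ha₂⟩ := ha
    obtain ⟨M, hb₁, hb₂⟩ := hb
    refine ⟨K + M, ?_, ?_⟩
    · refine pre.trans ?_ ((gs.pre_mul_left_iff a).2 hb₁)
      rw [Nat.cast_add, neg_add, zpow_add]
      exact (gs.pre_mul_Delta_zpow_iff _).2 ha₁
    · refine pre.trans ((gs.pre_mul_left_iff a).2 hb₂) ?_
      rw [Nat.cast_add, zpow_add]
      exact (gs.pre_mul_Delta_zpow_iff _).2 ha₂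
  | inv a _ ha =>
    obtain ⟨K, ha₁, ha₂⟩ := ha
    refine ⟨K, ?_, ?_⟩
    · simpa [pre, mul_assoc] using (gs.conj_Delta_zpow_mem_iff (-K) _).2 ha₂
    · simpa [pre] using (gs.conj_Delta_zpow_mem_iff K _).2 ha₁

theorem finite_pre_Delta_pow (K : ℕ) :
    {a : G | gs.pre 1 a ∧ gs.pre a (gs.Δ ^ (K : ℤ))}.Finite := by
  let := gs.lattice
  induction K with
  | zero =>
    refine (Set.finite_singleton (1 : G)).subset fun a ha => ?_
    exact (pre.antisymm ha.1 (by simpa using ha.2)).symm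
  | succ K ih =>
    refine (Set.Finite.image2 (fun e f => e * f) ih gs.simples_finite).subset fun a ha => ?_
    refine ⟨gs.wedge a (gs.Δ ^ (K : ℤ)), ⟨gs.le_wedge _ _ _ ha.1 ?_, gs.wedge_le_right _ _⟩,
      (gs.wedge a (gs.Δ ^ (K : ℤ)))⁻¹ * a, ⟨gs.wedge_le_left _ _, ?_⟩, by simp⟩
    · simpa [pre] using gs.Delta_pow_mem K
    · have h : gs.pre a (gs.twist 1 1 (gs.wedge a (gs.Δ ^ (K : ℤ)))) := by
        rw [twist_wedge]
        refine gs.le_wedge _ _ _ ?_ ?_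
        · rw [twist_apply, one_mul, zpow_one]
          exact gs.pre_mul_Delta a
        · rw [twist_apply, one_mul, ← zpow_add]
          exact_mod_cast ha.2
      simpa [twist_apply, pre, mul_assoc] using h

theorem finite_interval (a b : G) : {c : G | gs.pre a c ∧ gs.pre c b}.Finite := by
  obtain ⟨K, -, hK⟩ := gs.exists_Delta_pow_bounds (a⁻¹ * b)
  refine ((gs.finite_pre_Delta_pow K).image (a * ·)).subset fun c hc => ?_
  refine ⟨a⁻¹ * c, ⟨?_, ?_⟩, by simp⟩
  · simpa [pre] using hc.1
  · exact ((gs.pre_mul_left_iff _).2 hc.2).trans hK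

theorem eq_one_of_Delta_eq_one (h : gs.Δ = 1) (g : G) : g = 1 := by
  have hg : g ∈ (⊤ : Subgroup G) := trivial
  rw [← gs.simples_generate, h] at hg
  have hle : Subgroup.closure {s : G | s ∈ gs.P ∧ s⁻¹ * 1 ∈ gs.P} ≤ ⊥ :=
    (Subgroup.closure_le _).2 fun s hs =>
      gs.eq_one_of_mem_of_inv_mem s hs.1 (by simpa using hs.2)
  exact Subgroup.mem_bot.1 (hle hg)

variable {gs} in
theorem pre_Delta_zpow_iff (hΔ : gs.Δ ≠ 1) {r t : ℤ} :
    gs.pre (gs.Δ ^ r) (gs.Δ ^ t) ↔ r ≤ t := by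
  rw [pre, ← zpow_neg, ← zpow_add]
  constructor
  · intro h
    by_contra! hlt
    obtain ⟨n, hn⟩ := Int.eq_ofNat_of_zero_le (show 0 ≤ r - t - 1 by lia)
    have h1 : gs.Δ⁻¹ = gs.Δ ^ n * gs.Δ ^ (-r + t) := by
      rw [← zpow_natCast, ← zpow_add, ← hn, ← zpow_neg_one]
      congr 1
      ring
    refine hΔ (gs.eq_one_of_mem_of_inv_mem _ gs.Δ_mem ?_)
    rw [h1]
    exact gs.mul_mem (gs.Delta_pow_mem n) h
  · intro h
    obtain ⟨n, hn⟩ := Int.eq_ofNat_of_zero_le (show 0 ≤ -r + t by lia)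
    rw [hn]
    exact_mod_cast gs.Delta_pow_mem n

variable {gs} in
theorem le_ginf_iff (hΔ : gs.Δ ≠ 1) {r : ℤ} {x : G} :
    r ≤ gs.ginf x ↔ gs.pre (gs.Δ ^ r) x := by
  obtain ⟨K, hK₁, hK₂⟩ := gs.exists_Delta_pow_bounds x
  have hbdd : BddAbove {p : ℤ | gs.pre (gs.Δ ^ p) x} :=
    ⟨K, fun p hp => (pre_Delta_zpow_iff hΔ).1 (pre.trans hp hK₂)⟩
  refine ⟨fun h => ?_, fun h => le_csSup hbdd h⟩
  exact ((pre_Delta_zpow_iff hΔ).2 h).trans (Int.csSup_mem ⟨_, hK₁⟩ hbdd)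

variable {gs} in
theorem gsup_le_iff (hΔ : gs.Δ ≠ 1) {r : ℤ} {x : G} :
    gs.gsup x ≤ r ↔ gs.pre x (gs.Δ ^ r) := by
  obtain ⟨K, hK₁, hK₂⟩ := gs.exists_Delta_pow_bounds x
  have hbdd : BddBelow {p : ℤ | gs.pre x (gs.Δ ^ p)} :=
    ⟨-K, fun p hp => (pre_Delta_zpow_iff hΔ).1 (pre.trans hK₁ hp)⟩
  refine ⟨fun h => ?_, fun h => csInf_le hbdd h⟩
  exact pre.trans (Int.csInf_mem (s := {p : ℤ | gs.pre x (gs.Δ ^ p)}) ⟨_, hK₂⟩ hbdd)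
    ((pre_Delta_zpow_iff hΔ).2 h)

/-- Sliding of conjugating elements: `a ↦ yaΔ^{-p} ∧ y⁻¹aΔ^q ∧ aΔ`. -/
def slide (y : G) (p q : ℤ) : G → G :=
  letI := gs.lattice
  slideMap (gs.twist y (-p)) (gs.twist y⁻¹ q) (gs.twist 1 1)

theorem slide_iterate_mono (y : G) (p q : ℤ) (n : ℕ) {a b : G} (h : gs.pre a b) :
    gs.pre ((gs.slide y p q)^[n] a) ((gs.slide y p q)^[n] b) :=
  let := gs.lattice
  (slideMap_mono (gs.twist y (-p)) (gs.twist y⁻¹ q) (gs.twist 1 1)).iterate n h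

theorem twist_commute_slide {y h : G} (hy : Commute h y) (k p q : ℤ) :
    letI := gs.lattice
    Function.Commute (gs.twist h k) (gs.slide y p q) :=
  let := gs.lattice
  slideMap_commute (gs.twist_commute hy _ _) (gs.twist_commute hy.inv_right _ _)
    (gs.twist_commute (Commute.one_right h) _ _)

theorem slide_iterate_mul_left {y h : G} (hy : Commute h y) (p q : ℤ) (n : ℕ) (a : G) :
    (gs.slide y p q)^[n] (h * a) = h * (gs.slide y p q)^[n] a := by
  let := gs.lattice
  have := ((gs.twist_commute_slide hy 0 p q).iterate_right n) a
  simpa [twist_apply] using this.symm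

theorem slide_eq_mul_pp {y α : G} {p q : ℤ} (hp : gs.ginf (α⁻¹ * y * α) = p)
    (hq : gs.gsup (α⁻¹ * y * α) = q) :
    gs.slide y p q α = α * gs.pp (α⁻¹ * y * α) := by
  let := gs.lattice
  have h : ∀ a b, α * gs.wedge a b = gs.wedge (α * a) (α * b) := fun a b => by
    simpa [twist_apply] using gs.twist_wedge α 0 a b
  rw [pp, h, h, hp, hq, slide, slideMap, twist_apply, twist_apply, twist_apply]
  change gs.wedge (gs.wedge _ _) _ = _
  simp [mul_assoc]

variable {gs} in
theorem ginf_le_ginf_sl (hΔ : gs.Δ ≠ 1) (z : G) : gs.ginf z ≤ gs.ginf (gs.sl z) := by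
  let := gs.lattice
  have h := gs.slide_eq_mul_pp (y := z) (α := 1) rfl rfl
  simp only [inv_one, one_mul, mul_one] at h
  rw [le_ginf_iff hΔ, sl, ← h, pre_Delta_zpow_conj_iff, slide]
  have h1 : gs.pre 1 (gs.twist z (-gs.ginf z) 1) := by
    rw [← pre_Delta_zpow_conj_iff]
    simpa using (le_ginf_iff hΔ).1 (le_refl (gs.ginf z))
  exact le_apply_slideMap_iterate (Function.Commute.refl _)
    (gs.twist_commute (Commute.refl z).inv_right _ _)
    (gs.twist_commute (Commute.one_right _) _ _) h1 1

variable {gs} in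
theorem gsup_sl_le_gsup (hΔ : gs.Δ ≠ 1) (z : G) : gs.gsup (gs.sl z) ≤ gs.gsup z := by
  let := gs.lattice
  have h := gs.slide_eq_mul_pp (y := z) (α := 1) rfl rfl
  simp only [inv_one, one_mul, mul_one] at h
  rw [gsup_le_iff hΔ, sl, ← h, pre_conj_Delta_zpow_iff, slide]
  have h1 : gs.pre 1 (gs.twist z⁻¹ (gs.gsup z) 1) := by
    rw [← pre_conj_Delta_zpow_iff]
    simpa using (gsup_le_iff hΔ).1 (le_refl (gs.gsup z))
  exact le_apply_slideMap_iterate (gs.twist_commute (Commute.refl z).inv_left _ _)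
    (Function.Commute.refl _) (gs.twist_commute (Commute.one_right _) _ _) h1 1

variable {gs} in
theorem ginf_gsup_sl_iterate (hΔ : gs.Δ ≠ 1) (z : G) (n : ℕ) :
    gs.ginf z ≤ gs.ginf (gs.sl^[n] z) ∧ gs.gsup (gs.sl^[n] z) ≤ gs.gsup z := by
  induction n with
  | zero => exact ⟨le_rfl, le_rfl⟩
  | succ n ih =>
    rw [Function.iterate_succ_apply']
    exact ⟨ih.1.trans (ginf_le_ginf_sl hΔ _), (gsup_sl_le_gsup hΔ _).trans ih.2⟩

variable {gs} in
/-- `inf` and `sup` are constant along a sliding circuit. -/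
theorem ginf_gsup_sl_iterate_of_periodic (hΔ : gs.Δ ≠ 1) {z : G} {m : ℕ} (hm : 1 ≤ m)
    (hz : gs.sl^[m] z = z) (n : ℕ) :
    gs.ginf (gs.sl^[n] z) = gs.ginf z ∧ gs.gsup (gs.sl^[n] z) = gs.gsup z := by
  have h1 := ginf_gsup_sl_iterate hΔ z n
  have h2 := ginf_gsup_sl_iterate hΔ (gs.sl^[n] z) (m * n - n)
  rw [← Function.iterate_add_apply, Nat.sub_add_cancel (Nat.le_mul_of_pos_left n hm),
    Function.iterate_mul, Function.iterate_fixed hz] at h2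
  exact ⟨le_antisymm h2.1 h1.1, le_antisymm h1.2 h2.2⟩

/-- The element `α⁻¹yα` and all its iterated slidings have infimum `p` and supremum `q`. -/
def ConstAlong (y : G) (p q : ℤ) (α : G) : Prop :=
  ∀ i : ℕ, gs.ginf (gs.sl^[i] (α⁻¹ * y * α)) = p ∧ gs.gsup (gs.sl^[i] (α⁻¹ * y * α)) = q

variable {gs} in
theorem ConstAlong.conj_slide_iterate {y α : G} {p q : ℤ} (h : gs.ConstAlong y p q α) (n : ℕ) :
    ((gs.slide y p q)^[n] α)⁻¹ * y * (gs.slide y p q)^[n] α = gs.sl^[n] (α⁻¹ * y * α) := by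
  induction n with
  | zero => rfl
  | succ n ih =>
    have hn := h n
    rw [← ih] at hn
    rw [Function.iterate_succ_apply', Function.iterate_succ_apply',
      gs.slide_eq_mul_pp hn.1 hn.2, ← ih, sl]
    simp [mul_assoc]

variable {gs} in
theorem ConstAlong.slide_iterate_succ {y α : G} {p q : ℤ} (h : gs.ConstAlong y p q α) (n : ℕ) :
    (gs.slide y p q)^[n + 1] α =
      (gs.slide y p q)^[n] α * gs.pp (gs.sl^[n] (α⁻¹ * y * α)) := by
  have hn := h n
  rw [← h.conj_slide_iterate] at hn ⊢
  rw [Function.iterate_succ_apply', gs.slide_eq_mul_pp hn.1 hn.2]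

variable {gs} in
theorem ConstAlong.transportIter_eq {y α : G} {p q : ℤ} (h₁ : gs.ConstAlong y p q 1)
    (h : gs.ConstAlong y p q α) (n : ℕ) :
    gs.transportIter y α n = ((gs.slide y p q)^[n] 1)⁻¹ * (gs.slide y p q)^[n] α := by
  induction n with
  | zero => simp [transportIter]
  | succ n ih =>
    have e₁ := h₁.conj_slide_iterate n
    rw [transportIter, ih, transport, h₁.slide_iterate_succ, h.slide_iterate_succ,
      ← h.conj_slide_iterate n]
    simp only [inv_one, one_mul, mul_one] at e₁ ⊢
    rw [← e₁]
    simp [mul_assoc]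

variable {gs} in
/-- An element of a sliding circuit has extremal `inf` and `sup` in its conjugacy class. -/
theorem extremal_of_periodic (hΔ : gs.Δ ≠ 1) {y : G} {m : ℕ} (hm : 1 ≤ m)
    (hy : gs.sl^[m] y = y) (β : G) :
    gs.ginf (β⁻¹ * y * β) ≤ gs.ginf y ∧ gs.gsup y ≤ gs.gsup (β⁻¹ * y * β) := by
  let := gs.lattice
  set p := gs.ginf y with hp
  set q := gs.gsup y with hq
  have hc : gs.ConstAlong y p q 1 := fun i => by
    simpa using ginf_gsup_sl_iterate_of_periodic hΔ hm hy i
  have hinf : ∀ n, gs.ginf (((gs.slide y p q)^[n] 1)⁻¹ * y * (gs.slide y p q)^[n] 1) = p ∧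
      gs.gsup (((gs.slide y p q)^[n] 1)⁻¹ * y * (gs.slide y p q)^[n] 1) = q := fun n => by
    rw [hc.conj_slide_iterate]; exact hc n
  have hpq : p ≤ q :=
    (pre_Delta_zpow_iff hΔ).1 (((le_ginf_iff hΔ).1 hp.le).trans ((gsup_le_iff hΔ).1 hq.ge))
  obtain ⟨l, hl⟩ := Int.eq_ofNat_of_zero_le (show 0 ≤ q - p by lia)
  obtain ⟨K, hK₁, hK₂⟩ := gs.exists_Delta_pow_bounds β
  set γ := β * gs.Δ ^ (K : ℤ) with hγ
  have hγ₁ : gs.pre 1 γ := by simpa [hγ] using (gs.pre_mul_Delta_zpow_iff (K : ℤ)).2 hK₁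
  have hγ₂ : gs.pre γ ((gs.twist 1 1)^[K + K] 1) := by
    rw [twist_one_iterate]
    simpa [hγ, zpow_add, pow_add] using (gs.pre_mul_Delta_zpow_iff (K : ℤ)).2 hK₂
  have hφe : gs.pre 1 (gs.twist y (-p) 1) := by
    rw [← pre_Delta_zpow_conj_iff]; simpa using (le_ginf_iff hΔ).1 hp.le
  have hψe : gs.pre 1 (gs.twist y⁻¹ q 1) := by
    rw [← pre_conj_Delta_zpow_iff]; simpa using (gsup_le_iff hΔ).1 hq.ge
  have hφψ := gs.twist_commute (Commute.refl y).inv_right (-p) q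
  have hφD := gs.twist_commute (Commute.one_right y) (-p) 1
  have hψD := gs.twist_commute (Commute.one_right y⁻¹) q 1
  have hlD : ∀ a, gs.twist y (-p) (gs.twist y⁻¹ q a) = (gs.twist 1 1)^[l] a := fun a => by
    rw [twist_one_iterate, twist_apply, twist_apply, ← hl, sub_eq_add_neg, zpow_add]
    simp [mul_assoc]
  have hD : ∀ a, gs.pre a (gs.twist 1 1 a) := fun a => by
    simpa [twist_apply] using gs.pre_mul_Delta a
  have key : ∀ (z a : G) (r t : ℤ), t = r - 1 →
      (gs.pre (gs.twist 1 1 a) (gs.twist z r a) ↔ gs.pre a (gs.twist z t a)) :=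
    fun z a r t ht => by
      rw [twist_apply, twist_apply, twist_apply, ← gs.pre_mul_Delta_zpow_iff 1 (a := a), ht]
      simp [mul_assoc, zpow_sub_one]
  have shift : ∀ (z : G) (t : ℤ), gs.pre β (gs.twist z t β) → gs.pre γ (gs.twist z t γ) :=
    fun z t h => by
      have h2 := (gs.pre_mul_Delta_zpow_iff (K : ℤ)).2 h
      rw [twist_apply] at h2 ⊢
      rw [hγ]
      convert h2 using 1
      simp only [mul_assoc, ← zpow_add, add_comm t]
  constructor
  · by_contra! hlt
    have h1 : gs.pre γ (gs.twist y (-(p + 1)) γ) :=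
      shift _ _ ((gs.pre_Delta_zpow_conj_iff _ _ _).1 ((le_ginf_iff hΔ).1 hlt))
    obtain ⟨n, hn⟩ := exists_slideMap_iterate_le hφψ hφD hψD hlD hD gs.finite_interval
      hφe hψe hγ₁ hγ₂ ((key _ _ _ _ (by ring)).2 h1)
    have h2 := (le_ginf_iff hΔ).2
      ((gs.pre_Delta_zpow_conj_iff _ _ _).2 ((key _ _ _ (-(p + 1)) (by ring)).1 hn))
    have h3 := (hinf n).1
    rw [slide] at h3
    lia
  · by_contra! hlt
    have h1 : gs.pre γ (gs.twist y⁻¹ (q - 1) γ) :=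
      shift _ _ ((gs.pre_conj_Delta_zpow_iff _ _ _).1 ((gsup_le_iff hΔ).1 (by lia)))
    obtain ⟨n, hn⟩ := exists_slideMap_iterate_le hφψ.symm hψD hφD
      (fun a => (hφψ a).symm.trans (hlD a)) hD gs.finite_interval
      hψe hφe hγ₁ hγ₂ ((key _ _ _ _ rfl).2 h1)
    have h2 := (gsup_le_iff hΔ).2
      ((gs.pre_conj_Delta_zpow_iff _ _ _).2 ((key _ _ _ (q - 1) rfl).1 hn))
    have h3 := (hinf n).2
    rw [slide, slideMap_swap] at h3
    lia

variable {gs} in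
theorem SC_subset_SSS (hΔ : gs.Δ ≠ 1) (x : G) : gs.SC x ⊆ gs.SSS x := by
  rintro _ ⟨⟨α, rfl⟩, m, hm, hy⟩
  refine ⟨⟨α, rfl⟩, ?_⟩
  rintro _ ⟨β, rfl⟩
  simpa [mul_assoc] using extremal_of_periodic hΔ hm hy (α⁻¹ * β)

variable {gs} in
theorem constAlong_of_mem_SSS (hΔ : gs.Δ ≠ 1) {x y α : G} (hy : y ∈ gs.SSS x)
    (hα : α⁻¹ * y * α ∈ gs.SSS x) : gs.ConstAlong y (gs.ginf y) (gs.gsup y) α := by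
  intro i
  have hconj : ∀ n, ∃ δ : G, δ⁻¹ * x * δ = gs.sl^[n] (α⁻¹ * y * α) := fun n => by
    induction n with
    | zero => exact hα.1
    | succ n ih =>
      obtain ⟨δ, hδ⟩ := ih
      refine ⟨δ * gs.pp (gs.sl^[n] (α⁻¹ * y * α)), ?_⟩
      rw [Function.iterate_succ_apply', sl, ← hδ]
      simp [mul_assoc]
  have h1 := hy.2 _ (hconj i)
  have h2 := hα.2 _ hy.1
  have h3 := ginf_gsup_sl_iterate hΔ (α⁻¹ * y * α) i
  exact ⟨le_antisymm h1.1 (h2.1.trans h3.1), le_antisymm (h3.2.trans h2.2) h1.2⟩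

/-- The transport around a sliding circuit of length `N` starting at `y`. -/
def circuitMap (y : G) (p q : ℤ) (N : ℕ) (a : G) : G :=
  ((gs.slide y p q)^[N] 1)⁻¹ * (gs.slide y p q)^[N] a

theorem circuitMap_iterate_mono (y : G) (p q : ℤ) (N n : ℕ) {a b : G} (h : gs.pre a b) :
    gs.pre ((gs.circuitMap y p q N)^[n] a) ((gs.circuitMap y p q N)^[n] b) := by
  let := gs.lattice
  have hmono : Monotone (gs.circuitMap y p q N) := fun _ _ h =>
    (gs.pre_mul_left_iff _).2 (gs.slide_iterate_mono y p q N h)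
  exact hmono.iterate n h

theorem circuitMap_iterate_one (y : G) (p q : ℤ) (N n : ℕ) :
    (gs.circuitMap y p q N)^[n] 1 = 1 :=
  Function.iterate_fixed (by simp [circuitMap]) n

theorem slide_iterate_mul_eq {y : G} {p q : ℤ} {N : ℕ}
    (hg : Commute ((gs.slide y p q)^[N] 1) y) (i : ℕ) (a : G) :
    (gs.slide y p q)^[i * N] a =
      ((gs.slide y p q)^[N] 1) ^ i * (gs.circuitMap y p q N)^[i] a := by
  induction i with
  | zero => simp
  | succ i ih =>
    rw [Nat.succ_mul, Nat.add_comm, Function.iterate_add_apply, ih,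
      gs.slide_iterate_mul_left (hg.pow_left i), Function.iterate_succ_apply', circuitMap]
    simp [pow_succ, mul_assoc]

theorem circuitMap_iterate_Delta_zpow {y : G} {p q : ℤ} {N : ℕ}
    (hg : Commute ((gs.slide y p q)^[N] 1) y) (i : ℕ) (k : ℤ) :
    (gs.circuitMap y p q N)^[i] (gs.Δ ^ k) = gs.Δ ^ k := by
  let := gs.lattice
  have h := ((gs.twist_commute_slide (Commute.one_left y) k p q).iterate_right (i * N)) 1
  rw [gs.slide_iterate_mul_eq hg, gs.slide_iterate_mul_eq hg, circuitMap_iterate_one,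
    twist_apply, twist_apply] at h
  simpa using h.symm

variable {gs} in
theorem ConstAlong.commute_of_periodic {y : G} {p q : ℤ} (h : gs.ConstAlong y p q 1) {N : ℕ}
    (hN : gs.sl^[N] y = y) : Commute ((gs.slide y p q)^[N] 1) y := by
  have := h.conj_slide_iterate N
  simp only [inv_one, one_mul, mul_one, hN] at this
  rw [mul_assoc, inv_mul_eq_iff_eq_mul] at this
  exact this.symm

variable {gs} in
theorem ConstAlong.transportIter_mul {y α : G} {p q : ℤ} (h₁ : gs.ConstAlong y p q 1)
    (h : gs.ConstAlong y p q α) {N : ℕ} (hN : gs.sl^[N] y = y) (i : ℕ) :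
    gs.transportIter y α (i * N) = (gs.circuitMap y p q N)^[i] α := by
  have hg := h₁.commute_of_periodic hN
  rw [h₁.transportIter_eq h, gs.slide_iterate_mul_eq hg, gs.slide_iterate_mul_eq hg,
    circuitMap_iterate_one]
  simp

variable {gs} in
/-- A positive conjugator between two points on sliding circuits is periodic under transport
around the circuit of its source. -/
theorem ConstAlong.exists_circuitMap_period {y c : G} {p q : ℤ} (h₁ : gs.ConstAlong y p q 1)
    (h : gs.ConstAlong y p q c) {N m : ℕ} (hN : gs.sl^[N] y = y) (hm : 1 ≤ m)
    (hc : gs.sl^[m] (c⁻¹ * y * c) = c⁻¹ * y * c) (hc₁ : gs.pre 1 c) :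
    ∃ j, 1 ≤ j ∧ (gs.circuitMap y p q N)^[j] c = c := by
  have hg := h₁.commute_of_periodic hN
  set S := gs.slide y p q with hS
  set Θ := gs.circuitMap y p q N with hΘ
  obtain ⟨e, he⟩ : ∃ e, S^[m] c = e * c := ⟨_, (inv_mul_cancel_right _ _).symm⟩
  have hey : Commute e y := by
    have h2 := h.conj_slide_iterate m
    rw [hc, ← hS, he] at h2
    simp only [mul_inv_rev, mul_assoc, mul_right_inj] at h2
    rw [← mul_assoc, ← mul_assoc, mul_left_inj, mul_assoc,
      inv_mul_eq_iff_eq_mul] at h2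
    exact h2.symm
  have hSk : ∀ k, S^[k * m] c = e ^ k * c := fun k => by
    induction k with
    | zero => simp
    | succ k ih =>
      rw [Nat.succ_mul, Nat.add_comm, Function.iterate_add_apply, ih,
        gs.slide_iterate_mul_left (hey.pow_left k), pow_succ]
      rw [← hS, he, mul_assoc]
  have hΘk : ∀ k, Θ^[k * m] c = (((S^[N] 1) ^ m) ^ k)⁻¹ * ((e ^ N) ^ k * c) := fun k => by
    have h2 := gs.slide_iterate_mul_eq hg (k * m) c
    rw [← hS, mul_right_comm, hSk] at h2
    rw [eq_inv_mul_iff_mul_eq, ← pow_mul, ← pow_mul, mul_comm m, mul_comm N, h2]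
  obtain ⟨K, -, hK⟩ := gs.exists_Delta_pow_bounds c
  have hmem : ∀ k, Θ^[k * m] c ∈ {a : G | gs.pre 1 a ∧ gs.pre a (gs.Δ ^ (K : ℤ))} :=
    fun k => by
      have ha := gs.circuitMap_iterate_mono y p q N (k * m) hc₁
      have hb := gs.circuitMap_iterate_mono y p q N (k * m) hK
      rw [circuitMap_iterate_one] at ha
      rw [gs.circuitMap_iterate_Delta_zpow hg] at hb
      exact ⟨ha, hb⟩
  obtain ⟨k, k', hkk, heq⟩ := (gs.finite_pre_Delta_pow K).exists_lt_map_eq_of_forall_mem hmem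
  obtain ⟨d, rfl⟩ := Nat.exists_eq_add_of_lt hkk
  refine ⟨(d + 1) * m, Nat.mul_pos d.succ_pos hm, ?_⟩
  rw [hΘk, hΘk, show k + d + 1 = (d + 1) + k by ring, pow_add _ (d + 1), pow_add _ (d + 1),
    mul_inv_rev, mul_assoc, mul_right_inj, mul_assoc, ← mul_assoc _⁻¹, right_eq_mul] at heq
  rw [hΘk, ← mul_assoc, heq, one_mul]

end GarsideStructure

/-- If `p ⪯ c_s`, `y^p ∈ SSS(x)` and `F(p) ≠ {1}`, then either `c_s` is the element of
`F(p)` admitting `s` as a prefix, or `c_s` is not an indecomposable conjugator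
starting at `y`. -/
theorem fixed_points_of_transport (gs : GarsideStructure G) (x y s c p : G)
    (hy : y ∈ gs.SC x) (hs : s ∈ gs.P)
    (hc : gs.IsMinSCConj x y s c)
    (hp : p ∈ gs.P) (hpc : gs.pre p c) (hyp : p⁻¹ * y * p ∈ gs.SSS x)
    (N : ℕ) (hN : 0 < N) (hNy : (gs.sl)^[N] y = y)
    (hNmin : ∀ m : ℕ, 0 < m → (gs.sl)^[m] y = y → N ≤ m)
    (i₁ i₂ : ℕ) (h12 : i₁ < i₂)
    (heq : gs.transportIter y p (i₁ * N) = gs.transportIter y p (i₂ * N))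
    (hmin₁ : ∀ j₁ j₂ : ℕ, j₁ < j₂ →
      gs.transportIter y p (j₁ * N) = gs.transportIter y p (j₂ * N) → i₁ ≤ j₁)
    (hmin₂ : ∀ j₂ : ℕ, i₁ < j₂ →
      gs.transportIter y p (i₁ * N) = gs.transportIter y p (j₂ * N) → i₂ ≤ j₂)
    (F : Set G)
    (hF : F = {w : G | ∃ i : ℕ, i₁ ≤ i ∧ i < i₂ ∧ w = gs.transportIter y p (i * N)})
    (hF1 : F ≠ {1}) :
    (∀ v ∈ F, gs.pre s v → c = v) ∧
    ((∀ v ∈ F, ¬ gs.pre s v) → ¬ gs.IsIndecomposableConjugator x y c) := by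
  by_cases hΔ : gs.Δ = 1
  · refine absurd ?_ hF1
    rw [hF]
    ext w
    simp only [Set.mem_ofPred_eq, Set.mem_singleton_iff, gs.eq_one_of_Delta_eq_one hΔ w,
      gs.eq_one_of_Delta_eq_one hΔ (gs.transportIter _ _ _)]
    exact iff_of_true ⟨i₁, le_rfl, h12, trivial⟩ trivial
  have hyS := SC_subset_SSS hΔ x hy
  have h1 : gs.ConstAlong y (gs.ginf y) (gs.gsup y) 1 :=
    constAlong_of_mem_SSS hΔ hyS (by simpa using hyS)
  have hpC := constAlong_of_mem_SSS hΔ hyS hyp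
  have hcC := constAlong_of_mem_SSS hΔ hyS (SC_subset_SSS hΔ x hc.2.1)
  have hg := h1.commute_of_periodic hNy
  have htr := h1.transportIter_mul hpC hNy
  simp only [htr] at heq hF
  have hone := gs.circuitMap_iterate_one y (gs.ginf y) (gs.gsup y) N
  have hmono := fun n {a b : G} (h : gs.pre a b) =>
    gs.circuitMap_iterate_mono y (gs.ginf y) (gs.gsup y) N n h
  have hc1 : gs.pre 1 c := pre.trans (by simpa [pre] using hs) hc.1
  obtain ⟨m, hm, hcm⟩ := hc.2.1.2
  obtain ⟨j, hj, hjc⟩ := h1.exists_circuitMap_period hcC hNy hm hcm hc1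
  -- conjugating `y` by an element of `F` gives an element of `SC(x)`
  have hSC : ∀ i, i₁ ≤ i →
      ((gs.circuitMap y (gs.ginf y) (gs.gsup y) N)^[i] p)⁻¹ * y *
        (gs.circuitMap y (gs.ginf y) (gs.gsup y) N)^[i] p ∈ gs.SC x := by
    intro i hi
    obtain ⟨⟨δ, hδ⟩, -⟩ := hy
    refine ⟨⟨δ * (gs.circuitMap y (gs.ginf y) (gs.gsup y) N)^[i] p, ?_⟩, (i₂ - i₁) * N,
      Nat.mul_pos (Nat.sub_pos_of_lt h12) hN, ?_⟩
    · rw [← hδ]; simp [mul_assoc]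
    have hconj : ∀ n, ((gs.circuitMap y (gs.ginf y) (gs.gsup y) N)^[n] p)⁻¹ * y *
        (gs.circuitMap y (gs.ginf y) (gs.gsup y) N)^[n] p = gs.sl^[n * N] (p⁻¹ * y * p) := by
      intro n
      rw [← hpC.conj_slide_iterate, gs.slide_iterate_mul_eq hg, mul_inv_rev]
      have := (hg.pow_left n).eq
      simp only [mul_assoc]
      rw [← mul_assoc y, ← this]
      simp [mul_assoc]
    rw [hconj, ← Function.iterate_add_apply, ← Nat.add_mul, ← hconj, ← hconj]
    obtain ⟨d, rfl⟩ := Nat.exists_eq_add_of_le hi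
    rw [show i₂ - i₁ + (i₁ + d) = d + i₂ by lia, Nat.add_comm i₁ d, Function.iterate_add_apply,
      ← heq, ← Function.iterate_add_apply]
  generalize gs.circuitMap y (gs.ginf y) (gs.gsup y) N = Θ at *
  have hmod : ∀ i, i₁ ≤ i → Θ^[i] p ∈ F := by
    intro i
    induction i using Nat.strong_induction_on with
    | _ i ih =>
      intro hi
      by_cases hlt : i < i₂
      · rw [hF]; exact ⟨i, hi, hlt, rfl⟩
      · have h2 := ih (i - i₂ + i₁) (by lia) (by lia)
        rwa [Function.iterate_add_apply, heq, ← Function.iterate_add_apply,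
          Nat.sub_add_cancel (by lia)] at h2
  constructor
  · intro v hv hsv
    rw [hF] at hv
    obtain ⟨i, hi, -, rfl⟩ := hv
    have hcv := hc.2.2 _ hsv (hSC i hi)
    have hvc : gs.pre (Θ^[i] p) (Θ^[i] c) := hmono i hpc
    refine hcv.antisymm (hvc.trans ?_)
    let := gs.lattice
    have hΘm : Monotone (Θ^[i]) := fun a b h => hmono i h
    have h2 := hΘm.monotone_iterate_of_le_map (hcv.trans hvc) hj
    simp only [Function.iterate_one, ← Function.iterate_mul] at h2
    rwa [mul_comm i j, Function.iterate_mul, Function.iterate_fixed hjc] at h2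
  · rintro hF' ⟨-, -, hind⟩
    have hi : i₁ ≤ j * i₁ := Nat.le_mul_of_pos_left _ hj
    refine hind ⟨Θ^[j * i₁] p, ⟨?_, ?_⟩, ⟨?_, ?_⟩, hSC _ hi⟩
    · have := hmono (j * i₁) (show gs.pre 1 p by simpa [pre] using hp)
      rwa [hone] at this
    · intro h
      refine hF1 (Set.eq_singleton_iff_nonempty_unique_mem.2 ⟨⟨_, hmod _ hi⟩, fun v hv => ?_⟩)
      rw [hF] at hv
      obtain ⟨a, ha, -, rfl⟩ := hv
      have hper : ∀ n, Θ^[a] p = Θ^[a + n * (i₂ - i₁)] p := fun n => by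
        induction n with
        | zero => simp
        | succ n ih =>
          have e₁ : a + n * (i₂ - i₁) = (a + n * (i₂ - i₁) - i₁) + i₁ := by lia
          have e₂ : a + (n + 1) * (i₂ - i₁) = (a + n * (i₂ - i₁) - i₁) + i₂ := by
            rw [Nat.succ_mul]; lia
          rw [ih, e₂, Function.iterate_add_apply _ _ i₂, ← heq, ← Function.iterate_add_apply, ← e₁]
      have hle : j * i₁ ≤ a + j * i₁ * (i₂ - i₁) :=
        (Nat.le_mul_of_pos_right _ (Nat.sub_pos_of_lt h12)).trans (Nat.le_add_left _ _)
      rw [hper (j * i₁), ← Nat.sub_add_cancel hle, Function.iterate_add_apply, h, hone]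
    · have := hmono (j * i₁) hpc
      rwa [Function.iterate_mul Θ j i₁, Function.iterate_fixed hjc,
        ← Function.iterate_mul] at this
    · intro h
      exact hF' _ (hmod _ hi) (h ▸ hc.1)
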